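/- arXiv:math/0502354 — 3 statements merged into one kernel-verified Lean document; each statement's English description precedes it below -/
import Mathlib

section
/- With β^N as defined, for every positive integer N and every index i with 1 ≤ i ≤ n+m, one has |log(α_i(β^N)/α_i(β^{N+1}))| < 2^{i−(n+m)}/N. -/
open scoped Real ENNReal
open Filter

/-- The Gauss-map iterates: `alphaIter θ k` is `α_{k+1}(θ)`, i.e. `alphaIter θ 0 = α_1(θ) = θ`
and `α_{i+1}(θ)` is the fractional part of `1/α_i(θ)`. -/
noncomputable def alphaIter (θ : ℝ) : ℕ → ℝ
  | 0 => θ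
  | k + 1 => Int.fract (1 / alphaIter θ k)

/-- `HasCF θ a` : `θ` is an irrational number in `(0,1)` whose continued fraction digits
are given by `a` (0-indexed: `a k` is the digit `a_{k+1}` in 1-indexed notation). -/
def HasCF (θ : ℝ) (a : ℕ → ℕ) : Prop :=
  θ ∈ Set.Ioo (0 : ℝ) 1 ∧ Irrational θ ∧ ∀ k, ⌊1 / alphaIter θ k⌋ = (a k : ℤ)

/-- Yoccoz's Brjuno function `Φ(θ) = Σ_{n≥1} α_1(θ)⋯α_{n-1}(θ)·log(1/α_n(θ))`,
as a real-valued sum. -/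
noncomputable def brjunoPhi (θ : ℝ) : ℝ :=
  ∑' k : ℕ, (∏ j ∈ Finset.range k, alphaIter θ j) * Real.log (1 / alphaIter θ k)

/-- Yoccoz's Brjuno function with values in `ℝ≥0∞` (all terms are nonnegative). -/
noncomputable def brjunoPhiE (θ : ℝ) : ℝ≥0∞ :=
  ∑' k : ℕ, ENNReal.ofReal ((∏ j ∈ Finset.range k, alphaIter θ j) * Real.log (1 / alphaIter θ k))

/-- Digits of the noble number `ω = [a_1,…,a_n,1,1,1,…]`. -/
def nobleDigits (n : ℕ) (a : ℕ → ℕ) : ℕ → ℕ := fun k => if k < n then a k else 1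

/-- Digits of `β^N = [a_1,…,a_n,1,…,1,N,1,1,…]`, with `N` in (1-indexed) position `n+m`. -/
def betaDigits (n m N : ℕ) (a : ℕ → ℕ) : ℕ → ℕ :=
  fun k => if k + 1 = n + m then N else if k < n then a k else 1

/-- Digits of `β^I = [a_1,…,a_n,1,…,1,b_{n+m},b_{n+m+1},…]`: the digits of the noble number
with the whole tail from (1-indexed) position `n+m` on replaced by the tail `b`. -/
def tailDigits (n m : ℕ) (a b : ℕ → ℕ) : ℕ → ℕ :=
  fun k => if k + 1 < n + m then (if k < n then a k else 1) else b k

theorem HasCF.irrational_alphaIter {θ : ℝ} {a : ℕ → ℕ} (h : HasCF θ a) (k : ℕ) :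
    Irrational (alphaIter θ k) := by
  induction k with
  | zero => exact h.2.1
  | succ k ih =>
    rw [alphaIter, Int.fract, one_div]
    exact ih.inv.sub_intCast _

theorem HasCF.alphaIter_pos {θ : ℝ} {a : ℕ → ℕ} (h : HasCF θ a) (k : ℕ) :
    0 < alphaIter θ k := by
  cases k with
  | zero => exact h.1.1
  | succ k => exact lt_of_le_of_ne (Int.fract_nonneg _) (h.irrational_alphaIter (k + 1)).ne_zero.symm

theorem HasCF.alphaIter_lt_one {θ : ℝ} {a : ℕ → ℕ} (h : HasCF θ a) (k : ℕ) :
    alphaIter θ k < 1 := by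
  cases k with
  | zero => exact h.1.2
  | succ k => exact Int.fract_lt_one _

theorem HasCF.alphaIter_eq {θ : ℝ} {a : ℕ → ℕ} (h : HasCF θ a) (k : ℕ) :
    alphaIter θ k = (a k + alphaIter θ (k + 1))⁻¹ := by
  have h1 : (⌊1 / alphaIter θ k⌋ : ℝ) + alphaIter θ (k + 1) = 1 / alphaIter θ k :=
    Int.floor_add_fract _
  rw [h.2.2 k, Int.cast_natCast] at h1
  rw [h1, one_div, inv_inv]

/-- The map `x ↦ 1 / (1 + x)` contracts distances on `(1/2, ∞)` by a factor of at least two. -/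
theorem abs_inv_one_add_sub_le {x y : ℝ} (hx : 1 / 2 < x) (hy : 1 / 2 < y) :
    |(1 + x)⁻¹ - (1 + y)⁻¹| ≤ 1 / 2 * |x - y| := by
  have hx0 : 0 < 1 + x := by linarith
  have hy0 : 0 < 1 + y := by linarith
  have h1 : (1 + x)⁻¹ - (1 + y)⁻¹ = -(x - y) / ((1 + x) * (1 + y)) := by
    field_simp
    ring
  have h2 : 2 ≤ (1 + x) * (1 + y) := by nlinarith
  rw [h1, abs_div, abs_neg, abs_of_pos (mul_pos hx0 hy0), div_le_iff₀ (mul_pos hx0 hy0)]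
  nlinarith [abs_nonneg (x - y)]

theorem HasCF.half_lt_alphaIter {θ : ℝ} {a : ℕ → ℕ} (h : HasCF θ a) {k : ℕ} (hk : a k = 1) :
    1 / 2 < alphaIter θ k := by
  rw [h.alphaIter_eq k, hk, Nat.cast_one, one_div]
  have h1 := h.alphaIter_pos (k + 1)
  have h2 := h.alphaIter_lt_one (k + 1)
  exact inv_strictAnti₀ (by linarith) (by linarith)

/-- A tail of continued fraction digits all equal to one determines the Gauss iterate. -/
theorem HasCF.alphaIter_eq_of_tail_one {θ η : ℝ} {a b : ℕ → ℕ} (hθ : HasCF θ a)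
    (hη : HasCF η b) {K : ℕ} (ha : ∀ k, K ≤ k → a k = 1) (hb : ∀ k, K ≤ k → b k = 1) :
    alphaIter θ K = alphaIter η K := by
  have key : ∀ j, |alphaIter θ K - alphaIter η K| ≤
      (1 / 2 : ℝ) ^ j * |alphaIter θ (K + j) - alphaIter η (K + j)| := by
    intro j
    induction j with
    | zero => simp
    | succ j ih =>
      refine ih.trans ?_
      rw [pow_succ, mul_assoc]
      gcongr
      have h1 := abs_inv_one_add_sub_le
        (hθ.half_lt_alphaIter (ha (K + j + 1) (by omega)))
        (hη.half_lt_alphaIter (hb (K + j + 1) (by omega)))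
      rw [hθ.alphaIter_eq (K + j), hη.alphaIter_eq (K + j), ha _ (by omega), hb _ (by omega),
        Nat.cast_one]
      exact h1
  have key' : ∀ j, |alphaIter θ K - alphaIter η K| ≤ (1 / 2 : ℝ) ^ j := by
    intro j
    refine (key j).trans (mul_le_of_le_one_right (by positivity) ?_)
    have h1 := hθ.alphaIter_pos (K + j)
    have h2 := hθ.alphaIter_lt_one (K + j)
    have h3 := hη.alphaIter_pos (K + j)
    have h4 := hη.alphaIter_lt_one (K + j)
    rw [abs_le]
    constructor <;> linarith
  have hlim := tendsto_pow_atTop_nhds_zero_of_lt_one (r := (1 / 2 : ℝ)) (by norm_num) (by norm_num)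
  have h0 := ge_of_tendsto' hlim key'
  exact sub_eq_zero.mp (abs_eq_zero.mp (le_antisymm h0 (abs_nonneg _)))

theorem log_add_sub_log_add_le {x y c : ℝ} (hy : 0 < y) (hyx : y ≤ x) (hx : x < 1)
    (hc : 1 ≤ c) :
    Real.log (c + x) - Real.log (c + y) ≤ 1 / 2 * (Real.log x - Real.log y) := by
  have hx0 : 0 < x := by linarith
  have hxy : x * y ≤ c ^ 2 := by nlinarith
  have h1 : (c + x) ^ 2 * y ≤ (c + y) ^ 2 * x := by
    nlinarith [mul_nonneg (sub_nonneg.mpr hxy) (sub_nonneg.mpr hyx)]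
  have h2 := Real.log_le_log (by positivity) h1
  rw [Real.log_mul (by positivity) hy.ne', Real.log_mul (by positivity) hx0.ne',
    Real.log_pow, Real.log_pow] at h2
  push_cast at h2
  linarith

theorem abs_log_inv_add_div_le {x y c : ℝ} (hy0 : 0 < y) (hx0 : 0 < x) (hx : x < 1)
    (hy : y < 1) (hc : 1 ≤ c) :
    |Real.log ((c + x)⁻¹ / (c + y)⁻¹)| ≤ 1 / 2 * |Real.log (x / y)| := by
  have hcx : 0 < c + x := by linarith
  have hcy : 0 < c + y := by linarith
  rw [Real.log_div (by positivity) (by positivity), Real.log_inv, Real.log_inv,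
    Real.log_div hx0.ne' hy0.ne']
  rcases le_total y x with h | h
  · have h1 := log_add_sub_log_add_le hy0 h hx hc
    have h2 : Real.log (c + y) ≤ Real.log (c + x) := Real.log_le_log hcy (by linarith)
    rw [abs_of_nonpos (by linarith), abs_of_nonneg (sub_nonneg.mpr (Real.log_le_log hy0 h))]
    linarith
  · have h1 := log_add_sub_log_add_le hx0 h hy hc
    have h2 : Real.log (c + x) ≤ Real.log (c + y) := Real.log_le_log hcx (by linarith)
    rw [abs_of_nonneg (by linarith), abs_of_nonpos (sub_nonpos.mpr (Real.log_le_log hx0 h))]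
    linarith

theorem abs_log_inv_div_inv_succ_lt {N t : ℝ} (hN : 0 < N) (ht : 0 < t) :
    |Real.log ((N + t)⁻¹ / (N + 1 + t)⁻¹)| < 1 / N := by
  have h1 : (N + t)⁻¹ / (N + 1 + t)⁻¹ = 1 + 1 / (N + t) := by
    field_simp
    ring
  have h2 : 0 < 1 / (N + t) := by positivity
  rw [h1, abs_of_pos (Real.log_pos (by linarith))]
  calc Real.log (1 + 1 / (N + t)) ≤ 1 + 1 / (N + t) - 1 := Real.log_le_sub_one_of_pos (by linarith)
    _ = 1 / (N + t) := by ring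
    _ < 1 / N := one_div_lt_one_div_of_lt hN (by linarith)

/-- Lemma `4lems` part 1: for `1 ≤ i ≤ n+m`,
`|log(α_i(β^N)/α_i(β^{N+1}))| < 2^{i-(n+m)}/N`. -/
theorem alpha_log_ratio_succ
    (n m : ℕ) (hm : 0 < m) (a : ℕ → ℕ) (ha : ∀ i < n, 0 < a i)
    (N : ℕ) (hN : 0 < N)
    (βN βN1 : ℝ)
    (hβN : HasCF βN (betaDigits n m N a))
    (hβN1 : HasCF βN1 (betaDigits n m (N + 1) a))
    (i : ℕ) (hi1 : 1 ≤ i) (hi2 : i ≤ n + m) :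
    |Real.log (alphaIter βN (i - 1) / alphaIter βN1 (i - 1))|
      < (2 : ℝ) ^ ((i : ℤ) - (n + m)) / N := by
  have key : ∀ j k, k + j + 1 = n + m →
      |Real.log (alphaIter βN k / alphaIter βN1 k)| < (1 / 2 : ℝ) ^ j / N := by
    intro j
    induction j with
    | zero =>
      intro k hk
      have htail : alphaIter βN (k + 1) = alphaIter βN1 (k + 1) := by
        refine hβN.alphaIter_eq_of_tail_one hβN1 ?_ ?_ <;> intro l hl <;>
          rw [betaDigits, if_neg (by omega), if_neg (by omega)]
      rw [hβN.alphaIter_eq k, hβN1.alphaIter_eq k, betaDigits, betaDigits, if_pos (by omega),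
        if_pos (by omega), ← htail, pow_zero, Nat.cast_add, Nat.cast_one]
      exact abs_log_inv_div_inv_succ_lt (by exact_mod_cast hN) (hβN.alphaIter_pos _)
    | succ j ih =>
      intro k hk
      have hlt := ih (k + 1) (by omega)
      have hdig : betaDigits n m N a k = betaDigits n m (N + 1) a k := by
        have hne : ¬ k + 1 = n + m := by omega
        simp only [betaDigits, if_neg hne]
      have hpos : 1 ≤ betaDigits n m (N + 1) a k := by
        rw [betaDigits, if_neg (by omega)]
        split_ifs with h
        · exact ha k h
        · exact le_rfl
      rw [hβN.alphaIter_eq k, hβN1.alphaIter_eq k, hdig]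
      refine (abs_log_inv_add_div_le (hβN1.alphaIter_pos _) (hβN.alphaIter_pos _)
        (hβN.alphaIter_lt_one _) (hβN1.alphaIter_lt_one _) (by exact_mod_cast hpos)).trans_lt ?_
      calc _ < 1 / 2 * ((1 / 2 : ℝ) ^ j / N) := by gcongr
        _ = (1 / 2 : ℝ) ^ (j + 1) / N := by ring
  have hexp : (2 : ℝ) ^ ((i : ℤ) - (n + m)) = (1 / 2 : ℝ) ^ (n + m - i) := by
    rw [one_div, inv_pow, ← zpow_natCast, ← zpow_neg]
    congr 1
    push_cast [hi2]
    ring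
  rw [hexp]
  exact key (n + m - i) (i - 1) (by omega)
end

section
/- With β^N as defined, for every positive integer N and every index i with 1 ≤ i < n+m−1, one has |log( log(1/α_i(β^N)) / log(1/α_i(β^1)) )| < 2^{i−(n+m)+1}. -/
open scoped Real ENNReal
open Filter

namespace HasCF

variable {θ : ℝ} {a : ℕ → ℕ}

theorem irrational_alphaIter_s5 (h : HasCF θ a) (k : ℕ) : Irrational (alphaIter θ k) := by
  induction k with
  | zero => exact h.2.1
  | succ k ih =>
    have h1 : Irrational (1 / alphaIter θ k) := by simpa using ih.inv
    exact h1.sub_intCast _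

theorem alphaIter_mem (h : HasCF θ a) (k : ℕ) : alphaIter θ k ∈ Set.Ioo (0 : ℝ) 1 := by
  cases k with
  | zero => exact h.1
  | succ k =>
    refine ⟨lt_of_le_of_ne (Int.fract_nonneg _) ?_, Int.fract_lt_one _⟩
    exact (h.irrational_alphaIter_s5 (k + 1)).ne_zero.symm

theorem one_div_alphaIter (h : HasCF θ a) (k : ℕ) :
    1 / alphaIter θ k = a k + alphaIter θ (k + 1) := by
  have := Int.floor_add_fract (1 / alphaIter θ k)
  rw [h.2.2 k] at this
  exact_mod_cast this.symm

theorem alphaIter_eq_s5 (h : HasCF θ a) (k : ℕ) :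
    alphaIter θ k = (a k + alphaIter θ (k + 1))⁻¹ := by
  rw [← h.one_div_alphaIter k, one_div, inv_inv]

theorem alphaIter_le_of_tail_one (h : HasCF θ a) (p : ℕ) (hp : 1 ≤ a p)
    (h1 : ∀ k, p < k → a k = 1) : alphaIter θ p ≤ 5 / 8 := by
  have e0 := h.alphaIter_eq_s5 p
  have e1 := h.alphaIter_eq_s5 (p + 1)
  have e2 := h.alphaIter_eq_s5 (p + 2)
  have e3 := h.alphaIter_eq_s5 (p + 3)
  rw [h1 _ (by omega), Nat.cast_one] at e1 e2 e3
  have b3 : (1 / 2 : ℝ) ≤ alphaIter θ (p + 3) := by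
    rw [e3, one_div]
    have := h.alphaIter_mem (p + 3 + 1)
    exact inv_anti₀ (by linarith [this.1]) (by linarith [this.2])
  have b2 : alphaIter θ (p + 2) ≤ 2 / 3 := by
    rw [e2, show (2 / 3 : ℝ) = (3 / 2)⁻¹ by norm_num]
    exact inv_anti₀ (by norm_num) (by linarith)
  have b1 : (3 / 5 : ℝ) ≤ alphaIter θ (p + 1) := by
    rw [e1, show (3 / 5 : ℝ) = (5 / 3)⁻¹ by norm_num]
    have := h.alphaIter_mem (p + 1 + 1)
    exact inv_anti₀ (by linarith [this.1]) (by linarith)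
  rw [e0, show (5 / 8 : ℝ) = (8 / 5)⁻¹ by norm_num]
  have : (1 : ℝ) ≤ a p := by exact_mod_cast hp
  exact inv_anti₀ (by norm_num) (by linarith)

end HasCF

theorem abs_log_add_sub_log_add_le_half {a x y : ℝ} (ha : 1 ≤ a) (hx : x ∈ Set.Ioo (0 : ℝ) 1)
    (hy : y ∈ Set.Ioo (0 : ℝ) 1) :
    |Real.log (a + x) - Real.log (a + y)| ≤ |Real.log x - Real.log y| / 2 := by
  wlog hyx : y ≤ x generalizing x y
  · rw [abs_sub_comm, abs_sub_comm (Real.log x)]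
    exact this hy hx (le_of_not_ge hyx)
  obtain ⟨hx0, hx1⟩ := hx
  obtain ⟨hy0, hy1⟩ := hy
  have hax : 0 < a + x := by linarith
  have hay : 0 < a + y := by linarith
  rw [abs_of_nonneg (sub_nonneg.2 (Real.log_le_log hay (by linarith))),
    abs_of_nonneg (sub_nonneg.2 (Real.log_le_log hy0 hyx))]
  have key : (a + x) ^ 2 * y ≤ (a + y) ^ 2 * x := by
    have h1 : x * y ≤ a ^ 2 := by nlinarith
    nlinarith [mul_nonneg (sub_nonneg.2 hyx) (sub_nonneg.2 h1)]
  have := Real.log_le_log (by positivity) key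
  rw [Real.log_mul (by positivity) hy0.ne', Real.log_mul (by positivity) hx0.ne',
    Real.log_pow, Real.log_pow] at this
  push_cast at this
  linarith

theorem abs_log_log_add_sub_log_log_add_le {a x y : ℝ} (ha : 1 ≤ a) (hx : 0 < x) (hy : 0 < y) :
    |Real.log (Real.log (a + x)) - Real.log (Real.log (a + y))| ≤ |Real.log x - Real.log y| := by
  wlog hyx : y ≤ x generalizing x y
  · rw [abs_sub_comm, abs_sub_comm (Real.log x)]
    exact this hy hx (le_of_not_ge hyx)
  have hay : 0 < a + y := by linarith
  have hlx : 0 < Real.log (a + x) := Real.log_pos (by linarith)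
  have hly : 0 < Real.log (a + y) := Real.log_pos (by linarith)
  rw [abs_of_nonneg (sub_nonneg.2 (Real.log_le_log hly (Real.log_le_log hay (by linarith)))),
    abs_of_nonneg (sub_nonneg.2 (Real.log_le_log hy hyx))]
  have h1 : Real.log (a + x) - Real.log (a + y) ≤ (x - y) / (a + y) := by
    rw [← Real.log_div (by linarith) hay.ne']
    refine (Real.log_le_sub_one_of_pos (by positivity)).trans_eq ?_
    field_simp
    ring
  have h2 : y / (a + y) ≤ Real.log (a + y) := by
    refine le_trans ?_ (Real.one_sub_inv_le_log_of_pos hay)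
    rw [div_le_iff₀ hay, sub_mul, inv_mul_cancel₀ hay.ne']
    linarith
  have key : Real.log (a + x) * y ≤ Real.log (a + y) * x := by
    have h3 := mul_le_mul_of_nonneg_left h1 hy.le
    have h4 := mul_le_mul_of_nonneg_left h2 (sub_nonneg.2 hyx)
    have h5 : y * ((x - y) / (a + y)) = (x - y) * (y / (a + y)) := by ring
    linarith
  have := Real.log_le_log (by positivity) key
  rw [Real.log_mul hlx.ne' hy.ne', Real.log_mul hly.ne' hx.ne'] at this
  linarith

theorem abs_log_add_sub_log_add_lt_half {a x y : ℝ} (ha : 1 ≤ a) (hx : x ∈ Set.Icc (0 : ℝ) (5 / 8))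
    (hy : y ∈ Set.Icc (0 : ℝ) (5 / 8)) :
    |Real.log (a + x) - Real.log (a + y)| < 1 / 2 := by
  wlog hyx : y ≤ x generalizing x y
  · rw [abs_sub_comm]
    exact this hy hx (le_of_not_ge hyx)
  have hay : 0 < a + y := by linarith [hy.1]
  have hax : 0 < a + x := by linarith [hx.1]
  rw [abs_of_nonneg (sub_nonneg.2 (Real.log_le_log hay (by linarith))),
    ← Real.log_div hax.ne' hay.ne']
  have h1 : (a + x) / (a + y) ≤ 13 / 8 := by
    rw [div_le_iff₀ hay]
    linarith [hx.2, hy.1]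
  refine (Real.log_le_log (by positivity) h1).trans_lt ?_
  have h2 : Real.log ((13 / 8) ^ 2) < 1 := by
    rw [Real.log_lt_iff_lt_exp (by norm_num)]
    exact lt_trans (by norm_num) Real.exp_one_gt_d9
  rw [Real.log_pow] at h2
  push_cast at h2
  linarith

/-- If two continued fractions agree before position `p` and both `p`-th Gauss iterates lie below
`5 / 8`, the logarithms of the earlier iterates are exponentially close. -/
theorem HasCF.abs_log_alphaIter_sub_lt {θ η : ℝ} {b c : ℕ → ℕ} (hθ : HasCF θ b) (hη : HasCF η c)
    {p : ℕ} (hbc : ∀ k < p, b k = c k) (hb : ∀ k < p, 1 ≤ b k)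
    (hθp : alphaIter θ p ≤ 5 / 8) (hηp : alphaIter η p ≤ 5 / 8) (d j : ℕ) (hj : j + d + 1 = p) :
    |Real.log (alphaIter θ j) - Real.log (alphaIter η j)| < (1 / 2) ^ (d + 1) := by
  have hstep : |Real.log (alphaIter θ j) - Real.log (alphaIter η j)| =
      |Real.log (b j + alphaIter θ (j + 1)) - Real.log (b j + alphaIter η (j + 1))| := by
    rw [hθ.alphaIter_eq_s5 j, hη.alphaIter_eq_s5 j, ← hbc j (by omega), Real.log_inv, Real.log_inv,
      neg_sub_neg, abs_sub_comm]
  have hbj : (1 : ℝ) ≤ b j := by exact_mod_cast hb j (by omega)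
  rw [hstep]
  induction d generalizing j with
  | zero =>
    subst hj
    simpa using abs_log_add_sub_log_add_lt_half hbj
      ⟨(hθ.alphaIter_mem _).1.le, hθp⟩ ⟨(hη.alphaIter_mem _).1.le, hηp⟩
  | succ d ih =>
    have hstep' : |Real.log (alphaIter θ (j + 1)) - Real.log (alphaIter η (j + 1))| =
        |Real.log (b (j + 1) + alphaIter θ (j + 1 + 1)) -
          Real.log (b (j + 1) + alphaIter η (j + 1 + 1))| := by
      rw [hθ.alphaIter_eq_s5 (j + 1), hη.alphaIter_eq_s5 (j + 1), ← hbc (j + 1) (by omega),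
        Real.log_inv, Real.log_inv, neg_sub_neg, abs_sub_comm]
    have h1 := ih (j + 1) (by omega) hstep' (by exact_mod_cast hb (j + 1) (by omega))
    rw [← hstep'] at h1
    have h2 := abs_log_add_sub_log_add_le_half hbj (hθ.alphaIter_mem (j + 1))
      (hη.alphaIter_mem (j + 1))
    rw [pow_succ]
    linarith

/-- Lemma `4lems` part 4: for `1 ≤ i < n+m-1`,
`|log( log(1/α_i(β^N)) / log(1/α_i(β^1)) )| < 2^{i-(n+m)+1}`. -/
theorem alpha_loglog_ratio_one
    (n m : ℕ) (hm : 0 < m) (a : ℕ → ℕ) (ha : ∀ i < n, 0 < a i)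
    (N : ℕ) (hN : 0 < N)
    (βN β1 : ℝ)
    (hβN : HasCF βN (betaDigits n m N a))
    (hβ1 : HasCF β1 (betaDigits n m 1 a))
    (i : ℕ) (hi1 : 1 ≤ i) (hi2 : i + 1 < n + m) :
    |Real.log (Real.log (1 / alphaIter βN (i - 1)) / Real.log (1 / alphaIter β1 (i - 1)))|
      < (2 : ℝ) ^ ((i : ℤ) - (n + m) + 1) := by
  have hpos : ∀ M, 0 < M → ∀ k, 1 ≤ betaDigits n m M a k := by
    intro M hM k
    unfold betaDigits
    split_ifs with h1 h2
    exacts [hM, ha k h2, le_rfl]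
  have htail : ∀ M k, n + m - 1 < k → betaDigits n m M a k = 1 := by
    intro M k hk
    unfold betaDigits
    rw [if_neg (by omega), if_neg (by omega)]
  have hagree : ∀ k < n + m - 1, betaDigits n m N a k = betaDigits n m 1 a k := by
    intro k hk
    unfold betaDigits
    rw [if_neg (show ¬k + 1 = n + m by omega), if_neg (show ¬k + 1 = n + m by omega)]
  obtain ⟨q, rfl⟩ : ∃ q, i = q + 1 := ⟨i - 1, by omega⟩
  obtain ⟨d, hd⟩ : ∃ d, n + m = q + d + 3 := ⟨n + m - q - 3, by omega⟩
  have hexp : (2 : ℝ) ^ (((q + 1 : ℕ) : ℤ) - (n + m) + 1) = (1 / 2) ^ (d + 1) := by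
    have : ((q + 1 : ℕ) : ℤ) - (n + m) + 1 = -((d + 1 : ℕ) : ℤ) := by omega
    rw [this, zpow_neg, zpow_natCast, one_div, inv_pow]
  have hbq : (1 : ℝ) ≤ betaDigits n m N a q := by exact_mod_cast hpos N hN q
  have hxN := (hβN.alphaIter_mem (q + 1)).1
  have hx1 := (hβ1.alphaIter_mem (q + 1)).1
  rw [hexp, Nat.add_sub_cancel, hβN.one_div_alphaIter, hβ1.one_div_alphaIter,
    ← hagree q (by omega), Real.log_div (Real.log_pos (by linarith)).ne'
      (Real.log_pos (by linarith)).ne']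
  exact (abs_log_log_add_sub_log_log_add_le hbq hxN hx1).trans_lt
    (hβN.abs_log_alphaIter_sub_lt hβ1 hagree (fun k _ => hpos N hN k)
      (hβN.alphaIter_le_of_tail_one _ (hpos N hN _) (htail N))
      (hβ1.alphaIter_le_of_tail_one _ (hpos 1 one_pos _) (htail 1)) d (q + 1) (by omega))
end

section
/- Fix a finite sequence of positive integers (a_1,…,a_n) and ε > 0. For all sufficiently large integers m, for every positive integer N one has Φ¹(β^{N+1}) − Φ¹(β^N) < ε/2, where Φ¹(γ) = α_1(γ)α_2(γ)⋯α_{n+m−1}(γ)·log(1/α_{n+m}(γ)) denotes the (n+m)-th term of the Brjuno sum. -/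
open scoped Real ENNReal
open Filter

/-- The `(n+m)`-th term of the Brjuno sum:
`Φ¹(γ) = α_1(γ)⋯α_{n+m-1}(γ)·log(1/α_{n+m}(γ))`. -/
noncomputable def brjunoPhiOne (n m : ℕ) (γ : ℝ) : ℝ :=
  (∏ j ∈ Finset.range (n + m - 1), alphaIter γ j) * Real.log (1 / alphaIter γ (n + m - 1))

lemma alphaIter_mem_Ioo_and_irrational {θ : ℝ} (h : θ ∈ Set.Ioo (0 : ℝ) 1) (hi : Irrational θ)
    (k : ℕ) : alphaIter θ k ∈ Set.Ioo (0 : ℝ) 1 ∧ Irrational (alphaIter θ k) := by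
  induction k with
  | zero => exact ⟨h, hi⟩
  | succ k ih =>
    have hirr : Irrational (Int.fract (1 / alphaIter θ k)) := by
      rw [one_div]
      exact ih.2.inv.sub_intCast _
    exact ⟨⟨(Int.fract_nonneg _).lt_of_ne' hirr.ne_zero, Int.fract_lt_one _⟩, hirr⟩

lemma HasCF.alphaIter_mem_Ioo {θ : ℝ} {d : ℕ → ℕ} (h : HasCF θ d) (k : ℕ) :
    alphaIter θ k ∈ Set.Ioo (0 : ℝ) 1 :=
  (alphaIter_mem_Ioo_and_irrational h.1 h.2.1 k).1

lemma HasCF.one_div_alphaIter_s8 {θ : ℝ} {d : ℕ → ℕ} (h : HasCF θ d) (k : ℕ) :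
    1 / alphaIter θ k = d k + alphaIter θ (k + 1) := by
  have hk := Int.floor_add_fract (1 / alphaIter θ k)
  rw [h.2.2 k] at hk
  exact hk.symm

lemma HasCF.digit_pos {θ : ℝ} {d : ℕ → ℕ} (h : HasCF θ d) (k : ℕ) : 0 < d k := by
  have hk := h.alphaIter_mem_Ioo k
  have : (1 : ℤ) ≤ ⌊1 / alphaIter θ k⌋ := by
    rw [Int.le_floor, Int.cast_one]
    exact (one_lt_one_div hk.1 hk.2).le
  rw [h.2.2 k] at this
  exact_mod_cast this

/-- The denominators of the convergents of the continued fraction with digits `d`, shifted by one: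
`cfDenom d (k + 1)` is the denominator of `[d 0, …, d (k - 1)]`. -/
def cfDenom (d : ℕ → ℕ) : ℕ → ℕ
  | 0 => 0
  | 1 => 1
  | k + 2 => d k * cfDenom d (k + 1) + cfDenom d k

lemma cfDenom_add_le {d : ℕ → ℕ} (hd : ∀ k, 0 < d k) (k : ℕ) :
    cfDenom d k + cfDenom d (k + 1) ≤ cfDenom d (k + 2) := by
  rw [cfDenom]
  have := Nat.le_mul_of_pos_left (cfDenom d (k + 1)) (hd k)
  omega

lemma cfDenom_le_succ {d : ℕ → ℕ} (hd : ∀ k, 0 < d k) (k : ℕ) :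
    cfDenom d k ≤ cfDenom d (k + 1) := by
  cases k with
  | zero => simp [cfDenom]
  | succ k => exact (Nat.le_add_left _ _).trans (cfDenom_add_le hd k)

lemma fib_le_cfDenom {d : ℕ → ℕ} (hd : ∀ k, 0 < d k) (k : ℕ) : Nat.fib k ≤ cfDenom d k := by
  induction k using Nat.twoStepInduction with
  | zero => simp
  | one => simp [cfDenom]
  | more k h₀ h₁ =>
    rw [Nat.fib_add_two]
    exact (add_le_add h₀ h₁).trans (cfDenom_add_le hd k)

lemma cfDenom_congr {d e : ℕ → ℕ} {k : ℕ} (h : ∀ j, j + 1 < k → d j = e j) :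
    cfDenom d k = cfDenom e k := by
  induction k using Nat.twoStepInduction with
  | zero => rfl
  | one => rfl
  | more k h₀ h₁ =>
    rw [cfDenom, cfDenom, h k (by omega), h₀ fun j hj => h j (by omega),
      h₁ fun j hj => h j (by omega)]

lemma HasCF.prod_alphaIter {θ : ℝ} {d : ℕ → ℕ} (h : HasCF θ d) (k : ℕ) :
    ∏ j ∈ Finset.range k, alphaIter θ j =
      1 / (cfDenom d (k + 1) + cfDenom d k * alphaIter θ k) := by
  induction k with
  | zero => simp [cfDenom]
  | succ k ih =>
    have hα := (h.alphaIter_mem_Ioo k).1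
    have hD : (cfDenom d (k + 2) : ℝ) + cfDenom d (k + 1) * alphaIter θ (k + 1) =
        (cfDenom d (k + 1) + cfDenom d k * alphaIter θ k) / alphaIter θ k := by
      have hs : alphaIter θ (k + 1) = 1 / alphaIter θ k - d k := by
        rw [h.one_div_alphaIter_s8 k]; ring
      rw [hs, cfDenom]
      push_cast
      field_simp
      ring
    rw [Finset.prod_range_succ, ih, hD, one_div_div, one_div_mul_eq_div]

/-- If `A` and `B` are consecutive denominators and `x`, `y` tails whose inverses differ by at
most `2`, then the corresponding Brjuno terms differ by at most `3 / A`. -/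
lemma brjuno_term_sub_le {A B x y : ℝ} (hA : 0 < A) (hB : 0 ≤ B) (hBA : B ≤ A)
    (hx : x ∈ Set.Ioo (0 : ℝ) 1) (hy : y ∈ Set.Ioo (0 : ℝ) 1) (hxy : 1 / y ≤ 1 / x + 2) :
    1 / (A + B * y) * Real.log (1 / y) - 1 / (A + B * x) * Real.log (1 / x) ≤ 3 / A := by
  obtain ⟨hx0, hx1⟩ := hx
  obtain ⟨hy0, hy1⟩ := hy
  have hX : 1 < 1 / x := one_lt_one_div hx0 hx1
  have hY : 1 < 1 / y := one_lt_one_div hy0 hy1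
  have hlogX : 0 ≤ Real.log (1 / x) := Real.log_nonneg hX.le
  have hlogY : 0 ≤ Real.log (1 / y) := Real.log_nonneg hY.le
  have hlog : Real.log (1 / y) ≤ Real.log (1 / x) + 2 := by
    calc Real.log (1 / y) ≤ Real.log (1 / x * Real.exp 2) := by
          refine Real.log_le_log (by linarith) ?_
          nlinarith [Real.add_one_le_exp (2 : ℝ)]
      _ = Real.log (1 / x) + 2 := by
          rw [Real.log_mul (by positivity) (Real.exp_ne_zero _), Real.log_exp]
  have hxlog : x * Real.log (1 / x) ≤ 1 := by
    calc x * Real.log (1 / x) ≤ x * (1 / x) := by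
          gcongr
          exact Real.log_le_self (by positivity)
      _ = 1 := mul_one_div_cancel hx0.ne'
  have hP : 1 / (A + B * y) ≤ 1 / A :=
    one_div_le_one_div_of_le hA (by nlinarith)
  have hQ : (1 - x) / A ≤ 1 / (A + B * x) := by
    rw [div_le_div_iff₀ hA (by positivity)]
    nlinarith [mul_nonneg hB hx0.le, mul_nonneg (mul_nonneg hB hx0.le) hx0.le]
  calc 1 / (A + B * y) * Real.log (1 / y) - 1 / (A + B * x) * Real.log (1 / x)
      ≤ 1 / A * (Real.log (1 / x) + 2) - (1 - x) / A * Real.log (1 / x) := by gcongr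
    _ = (x * Real.log (1 / x) + 2) / A := by ring
    _ ≤ 3 / A := by gcongr; linarith

/-- Lemma `lem9`: for all sufficiently large `m`, `Φ¹(β^{N+1}) - Φ¹(β^N) < ε/2` for all `N`. -/
theorem phiOne_increment_small
    (n : ℕ) (a : ℕ → ℕ) (ha : ∀ i < n, 0 < a i)
    (ε : ℝ) (hε : 0 < ε) :
    ∃ m₀ : ℕ, 0 < m₀ ∧ ∀ m ≥ m₀, ∀ N : ℕ, 0 < N →
      ∀ βN βN1 : ℝ,
        HasCF βN (betaDigits n m N a) →
        HasCF βN1 (betaDigits n m (N + 1) a) →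
        brjunoPhiOne n m βN1 - brjunoPhiOne n m βN < ε / 2 := by
  obtain ⟨M, hM⟩ := exists_nat_gt (6 / ε)
  refine ⟨M + 5, by omega, fun m hm N _ β γ hβ hγ => ?_⟩
  obtain ⟨K, hK⟩ : ∃ K, n + m = K + 1 := ⟨n + m - 1, by omega⟩
  have hcongr : ∀ k ≤ K + 1,
      cfDenom (betaDigits n m (N + 1) a) k = cfDenom (betaDigits n m N a) k := fun k hk =>
    cfDenom_congr fun j hj => by
      have hj' : j + 1 ≠ n + m := by omega
      simp only [betaDigits, if_neg hj']
  have hMA : M ≤ cfDenom (betaDigits n m N a) (K + 1) :=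
    calc M ≤ K + 1 := by omega
      _ ≤ Nat.fib (K + 1) := Nat.le_fib_self (by omega)
      _ ≤ _ := fib_le_cfDenom hβ.digit_pos _
  have hA : 6 / ε < (cfDenom (betaDigits n m N a) (K + 1) : ℝ) :=
    hM.trans_le (by exact_mod_cast hMA)
  have hA0 : (0 : ℝ) < cfDenom (betaDigits n m N a) (K + 1) :=
    lt_trans (by positivity) hA
  have hinv : 1 / alphaIter γ K ≤ 1 / alphaIter β K + 2 := by
    have h₁ : betaDigits n m N a K = N := if_pos hK.symm
    have h₂ : betaDigits n m (N + 1) a K = N + 1 := if_pos hK.symm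
    rw [hβ.one_div_alphaIter_s8, hγ.one_div_alphaIter_s8, h₁, h₂]
    push_cast
    linarith [(hβ.alphaIter_mem_Ioo (K + 1)).1, (hγ.alphaIter_mem_Ioo (K + 1)).2]
  have hKsub : n + m - 1 = K := by omega
  rw [brjunoPhiOne, brjunoPhiOne, hKsub, hβ.prod_alphaIter, hγ.prod_alphaIter,
    hcongr _ le_rfl, hcongr K (by omega)]
  refine (brjuno_term_sub_le hA0 (Nat.cast_nonneg _)
    (by exact_mod_cast cfDenom_le_succ hβ.digit_pos K)
    (hβ.alphaIter_mem_Ioo K) (hγ.alphaIter_mem_Ioo K) hinv).trans_lt ?_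
  rw [div_lt_iff₀ hε] at hA
  rw [div_lt_iff₀ hA0]
  linarith
end
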